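/- Let M be a type of messages and T a type of transitions, each transition t carrying a trigger set trig t ⊆ M. Let L1, ..., Lk be lists of transitions (the outgoing transitions of a state and of its successive ancestors, checked bottom-up) and let A1, ..., Ak be lists of added transitions such that, for every 1 ≤ i ≤ k, the trigger set of each transition in Ai is disjoint from the union of the trigger sets of all transitions in Li, L_{i+1}, ..., Lk. Then for every message μ: if the first transition triggered by μ (i.e., the first transition t with μ ∈ trig t) in the concatenated list L1 ++ L2 ++ ... ++ Lk is t, then the first transition triggered by μ in the refined concatenated list (L1 ++ A1) ++ (L2 ++ A2) ++ ... ++ (Lk ++ Ak) is also t. -/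

import Mathlib

open Classical in
/-- The first transition in the list that can be triggered by message `μ`,
i.e. the first `t` with `μ ∈ trig t` (`none` if there is no such transition).
This models `next_t` checked over the outgoing transitions of a state and of
its ancestors in bottom-up order. -/
noncomputable def firstTrig {M T : Type*} (trig : T → Set M) (μ : M) :
    List T → Option T
  | [] => none
  | t :: ts => if μ ∈ trig t then some t else firstTrig trig μ ts

theorem firstTrig_append {M T : Type*} (trig : T → Set M) (μ : M) (l₁ l₂ : List T) :
    firstTrig trig μ (l₁ ++ l₂) = (firstTrig trig μ l₁).or (firstTrig trig μ l₂) := by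
  induction l₁ with
  | nil => simp [firstTrig]
  | cons a l ih =>
    by_cases ha : μ ∈ trig a <;> simp [firstTrig, ha, ih]

theorem firstTrig_eq_none {M T : Type*} {trig : T → Set M} {μ : M} {l : List T}
    (h : ∀ t ∈ l, μ ∉ trig t) : firstTrig trig μ l = none := by
  induction l with
  | nil => rfl
  | cons a l ih =>
    rw [firstTrig, if_neg (h a List.mem_cons_self)]
    exact ih fun t ht => h t (List.mem_cons_of_mem a ht)

theorem mem_and_mem_trig_of_firstTrig_eq_some {M T : Type*} {trig : T → Set M} {μ : M}
    {l : List T} {t : T} (h : firstTrig trig μ l = some t) : t ∈ l ∧ μ ∈ trig t := by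
  induction l with
  | nil => simp [firstTrig] at h
  | cons a l ih =>
    by_cases ha : μ ∈ trig a
    · obtain rfl : a = t := by simpa [firstTrig, ha] using h
      exact ⟨List.mem_cons_self, ha⟩
    · have hl := ih (by simpa [firstTrig, ha] using h)
      exact ⟨List.mem_cons_of_mem a hl.1, hl.2⟩

/-- Let `L 1, ..., L k` be lists of transitions and `Aadd 1, ...,
Aadd k` lists of added transitions such that the trigger set of each transition
in `Aadd i` is disjoint from the union of the trigger sets of all transitions
in `L i, L (i+1), ..., L k`.  Then for every message `μ`, if the first
transition triggered by `μ` in the concatenation `L 1 ++ ... ++ L k` is `t`,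
then the first transition triggered by `μ` in the refined concatenation
`(L 1 ++ Aadd 1) ++ ... ++ (L k ++ Aadd k)` is also `t`. -/
theorem firstTrig_refinement_preserved {M T : Type*} (trig : T → Set M)
    (k : ℕ) (L Aadd : Fin k → List T)
    (hdisj : ∀ i : Fin k, ∀ t ∈ Aadd i,
      Disjoint (trig t)
        (⋃ (j : Fin k) (_ : i ≤ j) (t' : T) (_ : t' ∈ L j), trig t'))
    (μ : M) (t : T)
    (h : firstTrig trig μ (List.flatten (List.ofFn L)) = some t) :
    firstTrig trig μ (List.flatten (List.ofFn fun i => L i ++ Aadd i)) = some t := by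
  induction k with
  | zero => simpa using h
  | succ k ih =>
    simp only [List.ofFn_succ, List.flatten_cons, firstTrig_append] at h ⊢
    cases h₀ : firstTrig trig μ (L 0) with
    | some s => simpa [h₀] using h
    | none =>
      have h_tail : firstTrig trig μ (List.ofFn fun i => L i.succ).flatten = some t := by
        simpa [h₀] using h
      obtain ⟨ht, hμ⟩ := mem_and_mem_trig_of_firstTrig_eq_some h_tail
      obtain ⟨j, hj⟩ : ∃ j : Fin k, t ∈ L j.succ := by simpa using ht
      have h_add : firstTrig trig μ (Aadd 0) = none := firstTrig_eq_none fun a ha hμa =>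
        Set.disjoint_left.1 (hdisj 0 a ha) hμa <| by
          simp only [Set.mem_iUnion]
          exact ⟨j.succ, Fin.zero_le _, t, hj, hμ⟩
      simp only [h_add, Option.none_or]
      refine ih (fun i => L i.succ) (fun i => Aadd i.succ) (fun i a ha => ?_) h_tail
      refine (hdisj i.succ a ha).mono_right fun x hx => ?_
      simp only [Set.mem_iUnion] at hx ⊢
      obtain ⟨j, hij, s, hs, hxs⟩ := hx
      exact ⟨j.succ, Fin.succ_le_succ_iff.2 hij, s, hs, hxs⟩
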